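/- arXiv:2203.02603 — 7 statements merged into one kernel-verified Lean document; each statement's English description precedes it below -/
import Mathlib

section
/- Let V and Q be real Hilbert spaces, T : V → Q a continuous surjective linear map, g ∈ Q, V_g = {v ∈ V : Tv = g}, and V_0 = ker T. Let a : V × V → ℝ be a symmetric positive-semidefinite bilinear form that is bounded (there exists M ≥ 0 with |a(w,v)| ≤ M·‖w‖·‖v‖ for all w, v ∈ V) and coercive on V_0 (there exists C > 0 with a(v,v) ≥ C·‖v‖² for all v ∈ V_0), and let f : V → ℝ be a continuous linear functional. Then there exists a unique u ∈ V_g such that a(u, δ) = f(δ) for every δ ∈ V_0. (Well-posedness of the abstract variational problem (V).) -/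
/-- Lax–Milgram: a coercive continuous bilinear form represents every continuous functional. -/
theorem IsCoercive.exists_forall_apply_eq {V : Type*} [NormedAddCommGroup V]
    [InnerProductSpace ℝ V] [CompleteSpace V] {B : V →L[ℝ] V →L[ℝ] ℝ} (hB : IsCoercive B)
    (l : V →L[ℝ] ℝ) : ∃ u : V, ∀ v : V, B u v = l v := by
  refine ⟨hB.continuousLinearEquivOfBilin.symm ((InnerProductSpace.toDual ℝ V).symm l),
    fun v => ?_⟩
  rw [← hB.continuousLinearEquivOfBilin_apply, ContinuousLinearEquiv.apply_symm_apply,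
    InnerProductSpace.toDual_symm_apply]

/-- Well-posedness of the abstract variational problem (V): for a bounded,
symmetric, positive-semidefinite bilinear form `a` that is coercive on
`V_0 = ker T`, with `T` a continuous surjective linear map and `f` a
continuous linear functional, there is a unique `u` with `T u = g` such that
`a(u, δ) = f(δ)` for all `δ ∈ ker T`. -/
theorem stmt_1 {V Q : Type*} [NormedAddCommGroup V] [InnerProductSpace ℝ V] [CompleteSpace V]
    [NormedAddCommGroup Q] [InnerProductSpace ℝ Q] [CompleteSpace Q]
    (T : V →L[ℝ] Q) (hT : Function.Surjective T) (g : Q)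
    (a : V →ₗ[ℝ] V →ₗ[ℝ] ℝ)
    (hsymm : ∀ w v : V, a w v = a v w) (hpsd : ∀ v : V, 0 ≤ a v v)
    (M : ℝ) (hM : 0 ≤ M) (hbdd : ∀ w v : V, |a w v| ≤ M * ‖w‖ * ‖v‖)
    (C : ℝ) (hC : 0 < C) (hcoer : ∀ v : V, T v = 0 → C * ‖v‖ ^ 2 ≤ a v v)
    (f : V →L[ℝ] ℝ) :
    ∃! u : V, T u = g ∧ ∀ δ : V, T δ = 0 → a u δ = f δ := by
  obtain ⟨u₀, hu₀⟩ := hT g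
  let A : V →L[ℝ] V →L[ℝ] ℝ := a.mkContinuous₂ M hbdd
  let K : Submodule ℝ V := T.ker
  have : CompleteSpace K := T.isClosed_ker.completeSpace_coe
  have hB : IsCoercive (A.bilinearComp K.subtypeL K.subtypeL) := by
    refine ⟨C, hC, fun v => ?_⟩
    have h := hcoer v v.2
    rwa [pow_two, ← mul_assoc] at h
  obtain ⟨w, hw⟩ := hB.exists_forall_apply_eq ((f - A u₀).comp K.subtypeL)
  have hwT : T w = 0 := w.2
  refine ⟨u₀ + w, ⟨by rw [map_add, hu₀, hwT, add_zero], fun δ hδ => ?_⟩, ?_⟩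
  · have h : a w δ = f δ - a u₀ δ := hw ⟨δ, hδ⟩
    rw [map_add, LinearMap.add_apply, h, add_sub_cancel]
  · rintro u ⟨huT, hu⟩
    have hd : T (u - (u₀ + w)) = 0 := by
      rw [map_sub, map_add, huT, hu₀, hwT, add_zero, sub_self]
    have h : a w (u - (u₀ + w)) = f (u - (u₀ + w)) - a u₀ (u - (u₀ + w)) := hw ⟨_, hd⟩
    have h0 : a (u - (u₀ + w)) (u - (u₀ + w)) = 0 := by
      rw [map_sub a, LinearMap.sub_apply, map_add a, LinearMap.add_apply, h, hu _ hd]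
      ring
    have hle := hcoer _ hd
    rw [h0] at hle
    have hsq : ‖u - (u₀ + w)‖ ^ 2 = 0 :=
      le_antisymm (nonpos_of_mul_nonpos_right hle hC) (sq_nonneg _)
    exact sub_eq_zero.mp (norm_eq_zero.mp (pow_eq_zero_iff two_ne_zero |>.mp hsq))
end

section
/- In the abstract Nitsche setting, assume the generalized trace inequality holds on V_h and the generalized Cauchy–Schwarz inequality holds on W for some γ > 1. Then the Nitsche bilinear form is coercive on V_h in the following quantitative sense: for every v ∈ V_h, a_h(v,v) ≥ (1 − 1/γ)·( a(v,v) + p(Tv,Tv) ). -/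
/-- Coercivity of the Nitsche bilinear form on the discrete space `V_h`:
under the generalized trace inequality on `V_h` and the generalized
Cauchy–Schwarz inequality on `W` with constant `γ > 1`, for every `v ∈ V_h`
one has `a_h(v,v) ≥ (1 − 1/γ)·(a(v,v) + p(Tv,Tv))`. -/
theorem stmt_3 {V Q : Type*} [NormedAddCommGroup V] [InnerProductSpace ℝ V] [CompleteSpace V]
    [NormedAddCommGroup Q] [InnerProductSpace ℝ Q] [CompleteSpace Q]
    (T : V →L[ℝ] Q) (W : Submodule ℝ V) (Vh : Submodule ℝ W)
    (a : V →ₗ[ℝ] V →ₗ[ℝ] ℝ)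
    (hasymm : ∀ w v : V, a w v = a v w) (hapsd : ∀ v : V, 0 ≤ a v v)
    (B : W →ₗ[ℝ] Q →L[ℝ] ℝ)
    (n : W →ₗ[ℝ] W →ₗ[ℝ] ℝ)
    (hnsymm : ∀ w v : W, n w v = n v w) (hnpsd : ∀ v : W, 0 ≤ n v v)
    (p : Q →ₗ[ℝ] Q →ₗ[ℝ] ℝ)
    (hpsymm : ∀ q r : Q, p q r = p r q) (hppsd : ∀ q : Q, 0 ≤ p q q)
    (ah : W → W → ℝ)
    (hah : ∀ w v : W, ah w v =
      a (w : V) (v : V) - B w (T (v : V)) - B v (T (w : V)) + p (T (w : V)) (T (v : V)))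
    (γ : ℝ) (hγ : 1 < γ)
    (htrace : ∀ v : Vh, n (v : W) (v : W) ≤ a ((v : W) : V) ((v : W) : V))
    (hCS : ∀ v w : W, |B v (T (w : V))| ≤
      (1 / γ) * Real.sqrt (n v v) * Real.sqrt (p (T (w : V)) (T (w : V)))) :
    ∀ v : Vh,
      (1 - 1 / γ) *
          (a ((v : W) : V) ((v : W) : V) + p (T ((v : W) : V)) (T ((v : W) : V))) ≤
        ah (v : W) (v : W) := by
  intro v
  have hB : B (v : W) (T ((v : W) : V)) ≤ _ := (le_abs_self _).trans (hCS v v)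
  have hyoung := two_mul_le_add_sq (Real.sqrt (n (v : W) (v : W)))
    (Real.sqrt (p (T ((v : W) : V)) (T ((v : W) : V))))
  rw [Real.sq_sqrt (hnpsd _), Real.sq_sqrt (hppsd _)] at hyoung
  have hγ_inv : 0 ≤ 1 / γ := by positivity
  have hscaled := mul_le_mul_of_nonneg_left
    (hyoung.trans (add_le_add_left (htrace v) _)) hγ_inv
  rw [hah]
  linarith
end

section
/- In the abstract Nitsche setting, assume the generalized trace inequality holds on V_h, the generalized Cauchy–Schwarz inequality holds on W for some γ > 1, V_h is finite-dimensional, and a(v,v) + p(Tv,Tv) > 0 for every nonzero v ∈ V_h. Then there exists a unique u_h ∈ V_h solving the Nitsche problem (N_h): a_h(u_h, δ) = f(δ) − ⟨Bδ, g⟩ + p(g, Tδ) for all δ ∈ V_h. (Well-posedness of Nitsche's method.) -/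
/-- Lax–Milgram in finite dimension: a positive definite bilinear form represents every linear
functional by a unique vector. -/
theorem LinearMap.existsUnique_eq_of_forall_apply_self_pos {E : Type*} [AddCommGroup E]
    [Module ℝ E] [FiniteDimensional ℝ E] (A : E →ₗ[ℝ] E →ₗ[ℝ] ℝ)
    (hA : ∀ v, v ≠ 0 → 0 < A v v) (F : E →ₗ[ℝ] ℝ) : ∃! u, A u = F := by
  have hinj : Function.Injective A := by
    rw [injective_iff_map_eq_zero]
    intro v hv
    by_contra hne
    simpa [hv] using hA v hne
  have hsurj : Function.Surjective A :=
    (LinearMap.injective_iff_surjective_of_finrank_eq_finrank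
      (Subspace.dual_finrank_eq (K := ℝ) (V := E)).symm).1 hinj
  exact Function.Bijective.existsUnique ⟨hinj, hsurj⟩ F

/-- The scalar coercivity estimate behind Nitsche's method. -/
theorem nitsche_form_pos {a n p b γ : ℝ} (hγ : 1 < γ) (ha : 0 ≤ a) (hp : 0 ≤ p)
    (hna : n ≤ a) (hb : |b| ≤ 1 / γ * √n * √p) (hpos : 0 < a + p) :
    0 < a - b - b + p := by
  have hγ' : 1 / γ < 1 := by rw [div_lt_one] <;> linarith
  have hγ₀ : 0 < 1 / γ := by positivity
  have hn : √n * √p ≤ √a * √p := by gcongr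
  have hap : 2 * (√a * √p) ≤ a + p := by
    nlinarith [sq_nonneg (√a - √p), Real.sq_sqrt ha, Real.sq_sqrt hp]
  have hb' : 2 * b ≤ 1 / γ * (a + p) := by
    have := mul_le_mul_of_nonneg_left (show 2 * (√n * √p) ≤ a + p by linarith) hγ₀.le
    linarith [le_abs_self b]
  linarith [mul_lt_mul_of_pos_right hγ' hpos]


/-- Well-posedness of Nitsche's method: under the generalized trace and
Cauchy–Schwarz inequalities (with `γ > 1`), finite-dimensionality of `V_h`,
and positive-definiteness of `a(v,v) + p(Tv,Tv)` on `V_h`, there exists a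
unique `u_h ∈ V_h` solving the Nitsche problem `(N_h)`. -/
theorem stmt_4 {V Q : Type*} [NormedAddCommGroup V] [InnerProductSpace ℝ V] [CompleteSpace V]
    [NormedAddCommGroup Q] [InnerProductSpace ℝ Q] [CompleteSpace Q]
    (T : V →L[ℝ] Q) (W : Submodule ℝ V) (Vh : Submodule ℝ W)
    [FiniteDimensional ℝ Vh]
    (a : V →ₗ[ℝ] V →ₗ[ℝ] ℝ)
    (hasymm : ∀ w v : V, a w v = a v w) (hapsd : ∀ v : V, 0 ≤ a v v)
    (B : W →ₗ[ℝ] Q →L[ℝ] ℝ)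
    (n : W →ₗ[ℝ] W →ₗ[ℝ] ℝ)
    (hnsymm : ∀ w v : W, n w v = n v w) (hnpsd : ∀ v : W, 0 ≤ n v v)
    (p : Q →ₗ[ℝ] Q →ₗ[ℝ] ℝ)
    (hpsymm : ∀ q r : Q, p q r = p r q) (hppsd : ∀ q : Q, 0 ≤ p q q)
    (f : V →L[ℝ] ℝ) (g : Q)
    (ah : W → W → ℝ)
    (hah : ∀ w v : W, ah w v =
      a (w : V) (v : V) - B w (T (v : V)) - B v (T (w : V)) + p (T (w : V)) (T (v : V)))
    (γ : ℝ) (hγ : 1 < γ)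
    (htrace : ∀ v : Vh, n (v : W) (v : W) ≤ a ((v : W) : V) ((v : W) : V))
    (hCS : ∀ v w : W, |B v (T (w : V))| ≤
      (1 / γ) * Real.sqrt (n v v) * Real.sqrt (p (T (w : V)) (T (w : V))))
    (hposdef : ∀ v : Vh, v ≠ 0 →
      0 < a ((v : W) : V) ((v : W) : V) + p (T ((v : W) : V)) (T ((v : W) : V))) :
    ∃! uh : Vh, ∀ δ : Vh,
      ah (uh : W) (δ : W) =
        f ((δ : W) : V) - B (δ : W) g + p g (T ((δ : W) : V)) := by
  let A : Vh →ₗ[ℝ] Vh →ₗ[ℝ] ℝ := LinearMap.mk₂ ℝ (fun w v : Vh => ah w v)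
    (by intros; simp [hah]; ring) (by intros; simp [hah]; ring)
    (by intros; simp [hah]; ring) (by intros; simp [hah]; ring)
  let S : Vh →ₗ[ℝ] V := W.subtype ∘ₗ Vh.subtype
  let F : Vh →ₗ[ℝ] ℝ :=
    f.toLinearMap ∘ₗ S - ((ContinuousLinearMap.apply ℝ ℝ g).toLinearMap ∘ₗ B) ∘ₗ Vh.subtype + p g ∘ₗ T.toLinearMap ∘ₗ S
  have hA : ∀ v : Vh, v ≠ 0 → 0 < A v v := fun v hv => by
    change 0 < ah v v
    rw [hah]
    exact nitsche_form_pos hγ (hapsd _) (hppsd _) (htrace v) (hCS v v) (hposdef v hv)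
  have hiff : ∀ u : Vh, A u = F ↔ ∀ δ : Vh,
      ah (u : W) (δ : W) = f ((δ : W) : V) - B (δ : W) g + p g (T ((δ : W) : V)) :=
    fun u => LinearMap.ext_iff
  simpa only [hiff] using A.existsUnique_eq_of_forall_apply_self_pos hA F
end

section
/- In the abstract Nitsche setting, suppose u ∈ W satisfies Tu = g and the Green's-identity relation a(u, v) = f(v) + ⟨Bu, Tv⟩ for every v ∈ V_h. Then u satisfies the Nitsche variational equation: a_h(u, δ) = f(δ) − ⟨Bδ, g⟩ + p(g, Tδ) for all δ ∈ V_h. Consequently, if u_h ∈ V_h solves the Nitsche problem (N_h), then the Galerkin orthogonality a_h(u − u_h, δ) = 0 holds for all δ ∈ V_h. (Variational consistency of Nitsche's method.) -/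
/-- Variational consistency of Nitsche's method: if `u ∈ W` satisfies `Tu = g`
and the Green's-identity relation `a(u,v) = f(v) + ⟨Bu, Tv⟩` for all `v ∈ V_h`,
then `u` satisfies the Nitsche variational equation, and consequently, if
`u_h` solves the Nitsche problem `(N_h)`, the Galerkin orthogonality
`a_h(u − u_h, δ) = 0` holds for all `δ ∈ V_h`. -/
theorem stmt_5 {V Q : Type*} [NormedAddCommGroup V] [InnerProductSpace ℝ V] [CompleteSpace V]
    [NormedAddCommGroup Q] [InnerProductSpace ℝ Q] [CompleteSpace Q]
    (T : V →L[ℝ] Q) (W : Submodule ℝ V) (Vh : Submodule ℝ W)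
    (a : V →ₗ[ℝ] V →ₗ[ℝ] ℝ)
    (hasymm : ∀ w v : V, a w v = a v w) (hapsd : ∀ v : V, 0 ≤ a v v)
    (B : W →ₗ[ℝ] Q →L[ℝ] ℝ)
    (p : Q →ₗ[ℝ] Q →ₗ[ℝ] ℝ)
    (hpsymm : ∀ q r : Q, p q r = p r q) (hppsd : ∀ q : Q, 0 ≤ p q q)
    (f : V →L[ℝ] ℝ) (g : Q)
    (ah : W → W → ℝ)
    (hah : ∀ w v : W, ah w v =
      a (w : V) (v : V) - B w (T (v : V)) - B v (T (w : V)) + p (T (w : V)) (T (v : V)))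
    (u : W) (hTu : T (u : V) = g)
    (hgreen : ∀ v : Vh, a (u : V) ((v : W) : V) = f ((v : W) : V) + B u (T ((v : W) : V))) :
    (∀ δ : Vh, ah u (δ : W) =
        f ((δ : W) : V) - B (δ : W) g + p g (T ((δ : W) : V))) ∧
      ∀ uh : Vh,
        (∀ δ : Vh, ah (uh : W) (δ : W) =
            f ((δ : W) : V) - B (δ : W) g + p g (T ((δ : W) : V))) →
          ∀ δ : Vh, ah (u - (uh : W)) (δ : W) = 0 := by
  have consistency : ∀ δ : Vh, ah u (δ : W) =
      f ((δ : W) : V) - B (δ : W) g + p g (T ((δ : W) : V)) := by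
    intro δ
    rw [hah, hTu, hgreen]
    ring
  refine ⟨consistency, fun uh huh δ => ?_⟩
  have ah_sub : ah (u - (uh : W)) (δ : W) = ah u (δ : W) - ah (uh : W) (δ : W) := by
    simp only [hah, Submodule.coe_sub, map_sub, LinearMap.sub_apply, sub_apply]
    ring
  rw [ah_sub, consistency, huh, sub_self]
end

section
/- In the abstract Nitsche setting, assume the generalized trace inequality holds on V_h and the generalized Cauchy–Schwarz inequality holds on W for some γ > 1. Suppose u ∈ W satisfies Tu = g and a(u, v) = f(v) + ⟨Bu, Tv⟩ for every v ∈ V_h, and suppose u_h ∈ V_h solves the Nitsche problem (N_h). Then the energy-norm error estimate holds: for every v_h ∈ V_h, |||u − u_h||| ≤ (1 + 2/(1 − 1/γ)) · |||u − v_h|||; in particular |||u − u_h||| ≤ (1 + 2/(1 − 1/γ)) · inf over v_h ∈ V_h of |||u − v_h|||. (Main error estimate of the abstract framework, Theorem on Well-Posedness and Error Estimate.) -/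
/-- Cauchy–Schwarz for a symmetric positive-semidefinite bilinear form, in square-root form. -/
theorem abs_apply_le_sqrt_mul_sqrt {E : Type*} [AddCommGroup E] [Module ℝ E]
    (b : E →ₗ[ℝ] E →ₗ[ℝ] ℝ) (hsymm : ∀ x y, b x y = b y x) (hpsd : ∀ x, 0 ≤ b x x) (x y : E) :
    |b x y| ≤ √(b x x) * √(b y y) := by
  rw [← Real.sqrt_mul (hpsd x)]
  refine Real.abs_le_sqrt ?_
  exact LinearMap.BilinForm.apply_sq_le_of_symm b hpsd ⟨fun x y ↦ hsymm x y⟩ x y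

/-- Triangle inequality for the seminorm of a symmetric positive-semidefinite bilinear form. -/
theorem sqrt_apply_add_le {E : Type*} [AddCommGroup E] [Module ℝ E]
    (b : E →ₗ[ℝ] E →ₗ[ℝ] ℝ) (hsymm : ∀ x y, b x y = b y x) (hpsd : ∀ x, 0 ≤ b x x) (x y : E) :
    √(b (x + y) (x + y)) ≤ √(b x x) + √(b y y) := by
  have h := (abs_le.1 (abs_apply_le_sqrt_mul_sqrt b hsymm hpsd x y)).2
  refine Real.sqrt_le_iff.2 ⟨by positivity, ?_⟩
  simp only [map_add, LinearMap.add_apply]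
  rw [hsymm y x, add_sq, Real.sq_sqrt (hpsd x), Real.sq_sqrt (hpsd y)]
  linarith

/-- Cauchy–Schwarz in `ℝ⁴` for the vectors `(a, n, p, p)` and `(a', p', n', p')`. -/
theorem mul_add_mul_le_sqrt_mul_sqrt (a n p a' n' p' : ℝ) :
    a * a' + n * p' + p * n' + p * p' ≤
      √(a ^ 2 + n ^ 2 + 2 * p ^ 2) * √(a' ^ 2 + n' ^ 2 + 2 * p' ^ 2) := by
  rw [← Real.sqrt_mul (by positivity)]
  refine Real.le_sqrt_of_sq_le ?_
  nlinarith [sq_nonneg (a * p' - n * a'), sq_nonneg (a * n' - p * a'),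
    sq_nonneg (a * p' - p * a'), sq_nonneg (n * n' - p * p'), sq_nonneg (n * p' - p * p'),
    sq_nonneg (p * p' - p * n')]

/-- Main error estimate of the abstract Nitsche framework: under the
generalized trace and Cauchy–Schwarz inequalities (with `γ > 1`), if `u ∈ W`
is consistent (satisfies `Tu = g` and the Green's identity against `V_h`)
and `u_h ∈ V_h` solves the Nitsche problem, then
`|||u − u_h||| ≤ (1 + 2/(1 − 1/γ)) · |||u − v_h|||` for every `v_h ∈ V_h`,
and in particular the same bound holds with the infimum over `v_h ∈ V_h`. -/
theorem stmt_6 {V Q : Type*} [NormedAddCommGroup V] [InnerProductSpace ℝ V] [CompleteSpace V]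
    [NormedAddCommGroup Q] [InnerProductSpace ℝ Q] [CompleteSpace Q]
    (T : V →L[ℝ] Q) (W : Submodule ℝ V) (Vh : Submodule ℝ W)
    (a : V →ₗ[ℝ] V →ₗ[ℝ] ℝ)
    (hasymm : ∀ w v : V, a w v = a v w) (hapsd : ∀ v : V, 0 ≤ a v v)
    (B : W →ₗ[ℝ] Q →L[ℝ] ℝ)
    (n : W →ₗ[ℝ] W →ₗ[ℝ] ℝ)
    (hnsymm : ∀ w v : W, n w v = n v w) (hnpsd : ∀ v : W, 0 ≤ n v v)
    (p : Q →ₗ[ℝ] Q →ₗ[ℝ] ℝ)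
    (hpsymm : ∀ q r : Q, p q r = p r q) (hppsd : ∀ q : Q, 0 ≤ p q q)
    (f : V →L[ℝ] ℝ) (g : Q)
    (ah : W → W → ℝ)
    (hah : ∀ w v : W, ah w v =
      a (w : V) (v : V) - B w (T (v : V)) - B v (T (w : V)) + p (T (w : V)) (T (v : V)))
    (Enorm : W → ℝ)
    (hEnorm : ∀ v : W, Enorm v =
      Real.sqrt (a (v : V) (v : V) + n v v + 2 * p (T (v : V)) (T (v : V))))
    (γ : ℝ) (hγ : 1 < γ)
    (htrace : ∀ v : Vh, n (v : W) (v : W) ≤ a ((v : W) : V) ((v : W) : V))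
    (hCS : ∀ v w : W, |B v (T (w : V))| ≤
      (1 / γ) * Real.sqrt (n v v) * Real.sqrt (p (T (w : V)) (T (w : V))))
    (u : W) (hTu : T (u : V) = g)
    (hgreen : ∀ v : Vh, a (u : V) ((v : W) : V) = f ((v : W) : V) + B u (T ((v : W) : V)))
    (uh : Vh)
    (hsolve : ∀ δ : Vh, ah (uh : W) (δ : W) =
      f ((δ : W) : V) - B (δ : W) g + p g (T ((δ : W) : V))) :
    (∀ vh : Vh, Enorm (u - (uh : W)) ≤
        (1 + 2 / (1 - 1 / γ)) * Enorm (u - (vh : W))) ∧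
      Enorm (u - (uh : W)) ≤
        (1 + 2 / (1 - 1 / γ)) * sInf {x : ℝ | ∃ vh : Vh, x = Enorm (u - (vh : W))} := by
  have hγ0 : 0 < 1 / γ := by positivity
  have hγ1 : 1 / γ < 1 := by rw [div_lt_one (by linarith)]; exact hγ
  have hc : 0 < 1 - 1 / γ := by linarith
  have henergy_nonneg (v : W) : 0 ≤ a (v : V) v + n v v + 2 * p (T v) (T v) := by
    linarith [hapsd v, hnpsd v, hppsd (T v)]
  have hEnorm_nonneg (v : W) : 0 ≤ Enorm v := by rw [hEnorm]; positivity
  have htriangle (v w : W) : Enorm (v + w) ≤ Enorm v + Enorm w := by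
    let b : W →ₗ[ℝ] W →ₗ[ℝ] ℝ := a.compl₁₂ W.subtype W.subtype + n +
      (2 : ℝ) • p.compl₁₂ (T.toLinearMap ∘ₗ W.subtype) (T.toLinearMap ∘ₗ W.subtype)
    have hb (x y : W) : b x y = a (x : V) y + n x y + 2 * p (T x) (T y) := by simp [b]
    have := sqrt_apply_add_le b (fun x y ↦ by rw [hb, hb, hasymm, hnsymm, hpsymm])
      (fun x ↦ by rw [hb]; exact henergy_nonneg x) v w
    simpa only [hb, ← hEnorm] using this
  have hcontinuous (w v : W) : ah w v ≤ Enorm w * Enorm v := by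
    have h := mul_add_mul_le_sqrt_mul_sqrt (√(a (w : V) w)) (√(n w w)) (√(p (T w) (T w)))
      (√(a (v : V) v)) (√(n v v)) (√(p (T v) (T v)))
    simp only [Real.sq_sqrt (hapsd _), Real.sq_sqrt (hnpsd _), Real.sq_sqrt (hppsd _),
      ← hEnorm] at h
    have hB (x y : W) : |B x (T (y : V))| ≤ √(n x x) * √(p (T y) (T y)) := by
      refine (hCS x y).trans ?_
      rw [mul_assoc]
      exact mul_le_of_le_one_left (by positivity) hγ1.le
    have ha := (abs_le.1 (abs_apply_le_sqrt_mul_sqrt a hasymm hapsd w v)).2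
    have hp := (abs_le.1 (abs_apply_le_sqrt_mul_sqrt p hpsymm hppsd (T w) (T v))).2
    have hwv := (abs_le.1 (hB w v)).1
    have hvw := (abs_le.1 (hB v w)).1
    rw [hah]
    linarith
  have hcoercive (d : Vh) : (1 - 1 / γ) / 2 * Enorm d ^ 2 ≤ ah d d := by
    rw [hEnorm, Real.sq_sqrt (henergy_nonneg _), hah]
    have hB := (abs_le.1 (hCS d d)).2
    have hn := htrace d
    have hyoung := two_mul_le_add_sq (√(n (d : W) d)) (√(p (T (d : W)) (T (d : W))))
    rw [Real.sq_sqrt (hnpsd _), Real.sq_sqrt (hppsd _)] at hyoung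
    have hyoung' := mul_le_mul_of_nonneg_left hyoung hγ0.le
    have hn' := mul_le_mul_of_nonneg_left hn (by linarith : 0 ≤ 1 + 1 / γ)
    linarith
  have horth (δ : Vh) : ah u δ = ah uh δ := by
    rw [hsolve, hah, hTu, hgreen]
    ring
  have hbound (vh : Vh) :
      Enorm (u - uh) ≤ (1 + 2 / (1 - 1 / γ)) * Enorm (u - vh) := by
    have heq : ah (uh - vh : Vh) (uh - vh : Vh) = ah (u - vh) (uh - vh : Vh) := by
      have h := horth (uh - vh)
      simp only [hah, Submodule.coe_sub, map_sub, LinearMap.sub_apply,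
        sub_apply] at h ⊢
      linarith
    have hd : Enorm (uh - vh : Vh) ≤ 2 / (1 - 1 / γ) * Enorm (u - vh) := by
      have h := (hcoercive (uh - vh)).trans (heq.le.trans (hcontinuous _ _))
      rw [div_mul_eq_mul_div, le_div_iff₀ hc]
      rcases (hEnorm_nonneg (uh - vh : Vh)).eq_or_lt with h0 | h0
      · rw [← h0, zero_mul]
        exact mul_nonneg zero_le_two (hEnorm_nonneg _)
      · refine le_of_mul_le_mul_right ?_ h0
        linarith
    have hneg : Enorm (-(uh - vh : Vh)) = Enorm (uh - vh : Vh) := by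
      simp only [hEnorm, Submodule.coe_neg, map_neg, LinearMap.neg_apply, neg_neg]
    have h := htriangle (u - vh) (-((uh - vh : Vh) : W))
    have hsplit : u - (vh : W) + -((uh - vh : Vh) : W) = u - uh := by
      rw [Submodule.coe_sub]; abel
    rw [hsplit, hneg] at h
    linarith
  refine ⟨hbound, ?_⟩
  have hK : 0 < 1 + 2 / (1 - 1 / γ) := by positivity
  rw [← div_le_iff₀' hK]
  refine le_csInf ⟨_, 0, rfl⟩ ?_
  rintro _ ⟨vh, rfl⟩
  rw [div_le_iff₀' hK]
  exact hbound vh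
end

section
/- Let V be a nonzero finite-dimensional real vector space, a : V × V → ℝ a symmetric positive-definite bilinear form, and b : V × V → ℝ a symmetric positive-semidefinite bilinear form. Then the Rayleigh quotient v ↦ b(v,v)/a(v,v) attains its supremum λ_max over nonzero v ∈ V at some u ≠ 0; this maximizer is a generalized eigenvector, i.e., b(u, δ) = λ_max · a(u, δ) for all δ ∈ V; and λ_max is the least constant C such that b(v,v) ≤ C · a(v,v) for all v ∈ V. (Min-max characterization of the optimal trace constant via a generalized eigenvalue problem.) -/
/-- A symmetric positive-semidefinite form vanishes against each of its isotropic vectors. -/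
theorem LinearMap.apply_eq_zero_of_isotropic {V : Type*} [AddCommGroup V] [Module ℝ V]
    (c : V →ₗ[ℝ] V →ₗ[ℝ] ℝ) (hsymm : ∀ w v : V, c w v = c v w) (hpsd : ∀ v : V, 0 ≤ c v v)
    {u : V} (hu : c u u = 0) (δ : V) : c u δ = 0 := by
  have hD := hpsd δ
  have h := hpsd ((c δ δ + 1) • u - c u δ • δ)
  simp only [map_sub, map_smul, LinearMap.sub_apply, LinearMap.smul_apply, smul_eq_mul,
    hsymm δ u, hu] at h
  have hsq : (c u δ) ^ 2 ≤ 0 := by nlinarith [mul_nonneg (sq_nonneg (c u δ)) hD]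
  exact pow_eq_zero_iff two_ne_zero |>.mp (le_antisymm hsq (sq_nonneg _))

/-- In coordinates, the quadratic map of a bilinear form is continuous. -/
theorem LinearMap.continuous_apply_self_comp {ι V : Type*} [Fintype ι] [AddCommGroup V]
    [Module ℝ V] (a : V →ₗ[ℝ] V →ₗ[ℝ] ℝ) (f : (ι → ℝ) →ₗ[ℝ] V) :
    Continuous fun x => a (f x) (f x) := by
  classical
  have h : (fun x => a (f x) (f x)) =
      fun x : ι → ℝ => ∑ i, x i * (a (f (Pi.single i 1)) ∘ₗ f) x := by
    funext x
    have hx : a (f x) = ∑ i, x i • a (f (Pi.single i 1)) := by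
      conv_lhs => rw [pi_eq_sum_univ' x]
      simp only [map_sum, map_smul]
    conv_lhs => rw [hx]
    simp [LinearMap.sum_apply]
  rw [h]
  exact continuous_finsetSum _ fun i _ =>
    (continuous_apply i).mul (LinearMap.continuous_of_finiteDimensional _)

/-- The Rayleigh quotient of two forms, the second positive definite, attains its maximum. -/
theorem LinearMap.exists_forall_rayleigh_le {V : Type*} [AddCommGroup V] [Module ℝ V]
    [FiniteDimensional ℝ V] [Nontrivial V] (a b : V →ₗ[ℝ] V →ₗ[ℝ] ℝ)
    (hapd : ∀ v : V, v ≠ 0 → 0 < a v v) :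
    ∃ u : V, u ≠ 0 ∧ ∀ v : V, v ≠ 0 → b v v / a v v ≤ b u u / a u u := by
  let e := (Module.finBasis ℝ V).equivFun
  have : Nontrivial (Fin (Module.finrank ℝ V) → ℝ) := e.symm.toEquiv.nontrivial
  have hne : ∀ x ∈ Metric.sphere (0 : Fin (Module.finrank ℝ V) → ℝ) 1, e.symm x ≠ 0 :=
    fun x hx => (map_ne_zero_iff _ e.symm.injective).mpr (ne_zero_of_mem_unit_sphere ⟨x, hx⟩)
  obtain ⟨x, hx, hmax⟩ := (isCompact_sphere (0 : Fin (Module.finrank ℝ V) → ℝ) 1).exists_isMaxOn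
    (NormedSpace.sphere_nonempty.mpr zero_le_one)
    ((b.continuous_apply_self_comp e.symm.toLinearMap).continuousOn.div
      (a.continuous_apply_self_comp e.symm.toLinearMap).continuousOn
      fun x hx => (hapd _ (hne x hx)).ne')
  refine ⟨e.symm x, hne x hx, fun v hv => ?_⟩
  have hev : ‖e v‖ ≠ 0 := norm_ne_zero_iff.mpr ((map_ne_zero_iff _ e.injective).mpr hv)
  have h := hmax (show ‖e v‖⁻¹ • e v ∈ Metric.sphere 0 1 by
    simp [norm_smul, inv_mul_cancel₀ hev])
  simp only [Set.mem_ofPred_eq, Pi.div_apply, LinearEquiv.coe_coe, map_smul, LinearEquiv.symm_apply_apply,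
    LinearMap.smul_apply, smul_eq_mul] at h
  rwa [mul_div_mul_left _ _ (inv_ne_zero hev), mul_div_mul_left _ _ (inv_ne_zero hev)] at h


/-- Min-max characterization of the optimal trace constant via a generalized
eigenvalue problem: on a nonzero finite-dimensional real vector space, with
`a` symmetric positive-definite and `b` symmetric positive-semidefinite, the
Rayleigh quotient `b(v,v)/a(v,v)` attains its supremum `λ_max` at some
`u ≠ 0`; the maximizer is a generalized eigenvector,
`b(u,δ) = λ_max·a(u,δ)` for all `δ`; and `λ_max` is the least constant `C`
with `b(v,v) ≤ C·a(v,v)` for all `v`. -/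
theorem stmt_9 {V : Type*} [AddCommGroup V] [Module ℝ V]
    [FiniteDimensional ℝ V] [Nontrivial V]
    (a b : V →ₗ[ℝ] V →ₗ[ℝ] ℝ)
    (hasymm : ∀ w v : V, a w v = a v w) (hapd : ∀ v : V, v ≠ 0 → 0 < a v v)
    (hbsymm : ∀ w v : V, b w v = b v w) (hbpsd : ∀ v : V, 0 ≤ b v v) :
    ∃ u : V, u ≠ 0 ∧
      (∀ v : V, v ≠ 0 → b v v / a v v ≤ b u u / a u u) ∧
      (∀ δ : V, b u δ = (b u u / a u u) * a u δ) ∧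
      (∀ v : V, b v v ≤ (b u u / a u u) * a v v) ∧
      (∀ C : ℝ, (∀ v : V, b v v ≤ C * a v v) → b u u / a u u ≤ C) := by
  obtain ⟨u, hu, hmax⟩ := a.exists_forall_rayleigh_le b hapd
  have hau := hapd u hu
  have hle : ∀ v : V, b v v ≤ (b u u / a u u) * a v v := fun v => by
    rcases eq_or_ne v 0 with rfl | hv
    · simp
    · exact (div_le_iff₀ (hapd v hv)).mp (hmax v hv)
  refine ⟨u, hu, hmax, fun δ => ?_, hle, fun C hC => (div_le_iff₀ hau).mpr (hC u)⟩
  have h := ((b u u / a u u) • a - b).apply_eq_zero_of_isotropic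
    (fun w v => by simp [hasymm w v, hbsymm w v]) (fun v => by simpa using hle v)
    (u := u) (by simp [div_mul_cancel₀ _ hau.ne']) δ
  simp only [LinearMap.sub_apply, LinearMap.smul_apply, smul_eq_mul] at h
  linarith
end

section
/- Let V and Q be real Hilbert spaces, T : V → Q a continuous linear map, g ∈ Q, V_g = {v ∈ V : Tv = g}, V_0 = ker T, and let a : V × V → ℝ be a bounded symmetric positive-semidefinite bilinear form that is coercive on V_0 (there exists C > 0 with a(v,v) ≥ C·‖v‖² for all v ∈ V_0), and f : V → ℝ a continuous linear functional. Let V_h ⊆ V be a finite-dimensional subspace such that V_g ∩ V_h is nonempty. Then there exists a unique u_h ∈ V_g ∩ V_h such that a(u_h, δ) = f(δ) for every δ ∈ V_0 ∩ V_h. (Well-posedness of the Bubnov–Galerkin approximation (V_h).) -/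
/-- A bilinear form that is definite on a finite-dimensional subspace `W` represents every linear
functional on `W`. -/
theorem LinearMap.exists_mem_forall_apply_eq_of_definite {K V : Type*} [Field K] [AddCommGroup V]
    [Module K V] (a : V →ₗ[K] V →ₗ[K] K) (W : Submodule K V) [FiniteDimensional K W]
    (hdef : ∀ w ∈ W, a w w = 0 → w = 0) (l : V →ₗ[K] K) :
    ∃ w ∈ W, ∀ δ ∈ W, a w δ = l δ := by
  let A : W →ₗ[K] Module.Dual K W := a.domRestrict₁₂ W W
  have hinj : Function.Injective A := by
    rw [← LinearMap.ker_eq_bot, LinearMap.ker_eq_bot']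
    intro w hw
    exact Subtype.ext (hdef w w.2 (LinearMap.congr_fun hw w))
  have hsurj : Function.Surjective A :=
    (LinearMap.injective_iff_surjective_of_finrank_eq_finrank
      Subspace.dual_finrank_eq.symm).mp hinj
  obtain ⟨w, hw⟩ := hsurj (l.domRestrict W)
  exact ⟨w, w.2, fun δ hδ => LinearMap.congr_fun hw ⟨δ, hδ⟩⟩

/-- Well-posedness of the Bubnov–Galerkin approximation (V_h): for a bounded,
symmetric, positive-semidefinite bilinear form `a` coercive on `ker T`, a
continuous linear functional `f`, and a finite-dimensional subspace `V_h`
whose trial set `V_g ∩ V_h` is nonempty, there exists a unique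
`u_h ∈ V_g ∩ V_h` with `a(u_h, δ) = f(δ)` for every `δ ∈ V_0 ∩ V_h`. -/
theorem stmt_18 {V Q : Type*} [NormedAddCommGroup V] [InnerProductSpace ℝ V] [CompleteSpace V]
    [NormedAddCommGroup Q] [InnerProductSpace ℝ Q] [CompleteSpace Q]
    (T : V →L[ℝ] Q) (g : Q)
    (a : V →ₗ[ℝ] V →ₗ[ℝ] ℝ)
    (hsymm : ∀ w v : V, a w v = a v w) (hpsd : ∀ v : V, 0 ≤ a v v)
    (M : ℝ) (hM : 0 ≤ M) (hbdd : ∀ w v : V, |a w v| ≤ M * ‖w‖ * ‖v‖)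
    (C : ℝ) (hC : 0 < C) (hcoer : ∀ v : V, T v = 0 → C * ‖v‖ ^ 2 ≤ a v v)
    (f : V →L[ℝ] ℝ)
    (Vh : Submodule ℝ V) [FiniteDimensional ℝ Vh]
    (hne : ∃ v ∈ Vh, T v = g) :
    ∃! uh : V, uh ∈ Vh ∧ T uh = g ∧ ∀ δ ∈ Vh, T δ = 0 → a uh δ = f δ := by
  have hdef (v : V) (hv : T v = 0) (hav : a v v = 0) : v = 0 := by
    have h := hcoer v hv
    rw [hav] at h
    have h2 : ‖v‖ ^ 2 ≤ 0 := nonpos_of_mul_nonpos_right h hC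
    exact norm_eq_zero.mp (pow_eq_zero_iff two_ne_zero |>.mp (h2.antisymm (sq_nonneg _)))
  obtain ⟨v, hv, hTv⟩ := hne
  obtain ⟨w, ⟨hw, hTw⟩, hwδ⟩ := a.exists_mem_forall_apply_eq_of_definite
    (Vh ⊓ T.toLinearMap.ker) (fun w hw => hdef w hw.2) (f.toLinearMap - a v)
  replace hTw : T w = 0 := hTw
  refine ⟨v + w, ⟨Vh.add_mem hv hw, by rw [map_add, hTv, hTw, add_zero], fun δ hδ hTδ => ?_⟩, ?_⟩
  · have h := hwδ δ ⟨hδ, hTδ⟩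
    rw [map_add, LinearMap.add_apply, h]
    simp
  · rintro u ⟨hu, hTu, huδ⟩
    have hd : u - (v + w) ∈ Vh := Vh.sub_mem hu (Vh.add_mem hv hw)
    have hTd : T (u - (v + w)) = 0 := by simp [hTu, hTv, hTw]
    refine sub_eq_zero.mp (hdef _ hTd ?_)
    have h1 := huδ _ hd hTd
    have h2 := hwδ _ ⟨hd, hTd⟩
    rw [LinearMap.sub_apply, ContinuousLinearMap.coe_coe] at h2
    rw [map_sub a, map_add a, LinearMap.sub_apply, LinearMap.add_apply, h1, h2]
    ring
end
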